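/- Let V be a three-dimensional real inner product space with orthonormal basis (e₁, e₂, N), let ξ ∈ V be a unit vector, set ν = ⟨N, ξ⟩, let a, ε ∈ ℝ, and define the bilinear form B(u,v) = a⟨u,v⟩ + ε·a·⟨u,ξ⟩⟨v,ξ⟩. Suppose X, Y ∈ V satisfy ⟨X,N⟩ = ⟨Y,N⟩ = 0, ⟨X,Y⟩ = 0 and ‖X‖ = ‖Y‖. Then Σ_{i=1}^{2} [ B(e_i, X)² + B(e_i, Y)² ] = a²·( 2 + 2ε(1 − ν²) + ε²(1 − ν²)² )·‖X‖². -/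

import Mathlib

open scoped InnerProductSpace

/-- If the rows of a real `2 × 2` matrix are orthogonal and have the same squared norm `r`,
then the columns are orthogonal and have squared norm `r`. -/
theorem columns_orthogonal_of_rows_orthogonal {x₁ x₂ y₁ y₂ r : ℝ}
    (hx : x₁ ^ 2 + x₂ ^ 2 = r) (hy : y₁ ^ 2 + y₂ ^ 2 = r) (hxy : x₁ * y₁ + x₂ * y₂ = 0) :
    x₁ ^ 2 + y₁ ^ 2 = r ∧ x₂ ^ 2 + y₂ ^ 2 = r ∧ x₁ * x₂ + y₁ * y₂ = 0 := by
  rcases eq_or_ne r 0 with rfl | hr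
  · have h₁ : x₁ = 0 := by nlinarith
    have h₂ : x₂ = 0 := by nlinarith
    have h₃ : y₁ = 0 := by nlinarith
    have h₄ : y₂ = 0 := by nlinarith
    simp [h₁, h₂, h₃, h₄]
  · have h : y₁ ^ 2 = x₂ ^ 2 := by
      apply mul_left_cancel₀ hr
      linear_combination (-y₁ ^ 2) * hx + x₂ ^ 2 * hy + (x₁ * y₁ - x₂ * y₂) * hxy
    refine ⟨by linarith, by linarith, mul_left_cancel₀ hr ?_⟩
    linear_combination (-y₁ * y₂) * hx - x₁ * x₂ * hy + (x₂ * y₁ + x₁ * y₂) * hxy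

/-- Coordinate expansion of the inner product in an orthonormal triple of a three-dimensional
space. -/
theorem inner_eq_of_orthonormal_triple {V : Type*} [NormedAddCommGroup V]
    [InnerProductSpace ℝ V] (hdim : Module.finrank ℝ V = 3) {e₁ e₂ e₃ : V}
    (h : Orthonormal ℝ ![e₁, e₂, e₃]) (u v : V) :
    ⟪u, v⟫_ℝ = ⟪e₁, u⟫_ℝ * ⟪e₁, v⟫_ℝ + ⟪e₂, u⟫_ℝ * ⟪e₂, v⟫_ℝ + ⟪e₃, u⟫_ℝ * ⟪e₃, v⟫_ℝ := by
  have hspan : ⊤ ≤ Submodule.span ℝ (Set.range ![e₁, e₂, e₃]) :=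
    (h.linearIndependent.span_eq_top_of_card_eq_finrank (by simp [hdim])).ge
  have key := (OrthonormalBasis.mk h hspan).sum_inner_mul_inner u v
  simp only [OrthonormalBasis.coe_mk, Fin.sum_univ_three, Matrix.cons_val] at key
  rw [← key, real_inner_comm u e₁, real_inner_comm u e₂, real_inner_comm u e₃]

/-- For `B(u,v) = a⟨u,v⟩ + εa⟨u,ξ⟩⟨v,ξ⟩` with `ξ` a unit vector, an orthonormal
basis `(e₁, e₂, N)` of a three-dimensional real inner product space,
`ν = ⟨N, ξ⟩`, and vectors `X, Y` orthogonal to `N`, mutually orthogonal and of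
equal norm, one has
`Σᵢ [B(eᵢ,X)² + B(eᵢ,Y)²] = a²(2 + 2ε(1−ν²) + ε²(1−ν²)²)‖X‖²`. -/
theorem stmt_3 {V : Type*} [NormedAddCommGroup V] [InnerProductSpace ℝ V]
    (hdim : Module.finrank ℝ V = 3)
    (e₁ e₂ N : V) (honb : Orthonormal ℝ ![e₁, e₂, N])
    (ξ : V) (hξ : ‖ξ‖ = 1)
    (ν : ℝ) (hν : ν = ⟪N, ξ⟫_ℝ)
    (a ε : ℝ)
    (B : V → V → ℝ)
    (hB : ∀ u v : V, B u v = a * ⟪u, v⟫_ℝ + ε * a * ⟪u, ξ⟫_ℝ * ⟪v, ξ⟫_ℝ)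
    (X Y : V)
    (hXN : ⟪X, N⟫_ℝ = 0) (hYN : ⟪Y, N⟫_ℝ = 0)
    (hXY : ⟪X, Y⟫_ℝ = 0) (hnorm : ‖X‖ = ‖Y‖) :
    (B e₁ X ^ 2 + B e₁ Y ^ 2) + (B e₂ X ^ 2 + B e₂ Y ^ 2)
      = a ^ 2 * (2 + 2 * ε * (1 - ν ^ 2) + ε ^ 2 * (1 - ν ^ 2) ^ 2) * ‖X‖ ^ 2 := by
  have exp := inner_eq_of_orthonormal_triple hdim honb
  have hNX : ⟪N, X⟫_ℝ = 0 := by rw [real_inner_comm, hXN]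
  have hNY : ⟪N, Y⟫_ℝ = 0 := by rw [real_inner_comm, hYN]
  have hX := exp X X
  have hY := exp Y Y
  have hξξ := exp ξ ξ
  have hXξ := exp X ξ
  have hYξ := exp Y ξ
  rw [exp X Y] at hXY
  rw [real_inner_self_eq_norm_sq] at hX hY hξξ
  rw [← hnorm] at hY
  rw [hξ, ← hν] at hξξ
  simp only [hNX, hNY, zero_mul, add_zero] at hX hY hXY hXξ hYξ
  simp only [hB, hXξ, hYξ]
  generalize ⟪e₁, X⟫_ℝ = x₁ at *
  generalize ⟪e₂, X⟫_ℝ = x₂ at *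
  generalize ⟪e₁, Y⟫_ℝ = y₁ at *
  generalize ⟪e₂, Y⟫_ℝ = y₂ at *
  generalize ⟪e₁, ξ⟫_ℝ = p at *
  generalize ⟪e₂, ξ⟫_ℝ = q at *
  generalize ‖X‖ ^ 2 = r at *
  obtain ⟨h₁, h₂, h₃⟩ := columns_orthogonal_of_rows_orthogonal
    (by linarith : x₁ ^ 2 + x₂ ^ 2 = r) (by linarith : y₁ ^ 2 + y₂ ^ 2 = r) hXY
  have hpq : 1 - ν ^ 2 = p ^ 2 + q ^ 2 := by linarith
  rw [hpq]
  linear_combination (a ^ 2 + a ^ 2 * (2 * ε + ε ^ 2 * (p ^ 2 + q ^ 2)) * p ^ 2) * h₁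
    + (a ^ 2 + a ^ 2 * (2 * ε + ε ^ 2 * (p ^ 2 + q ^ 2)) * q ^ 2) * h₂
    + 2 * a ^ 2 * (2 * ε + ε ^ 2 * (p ^ 2 + q ^ 2)) * p * q * h₃
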